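/- arXiv:2305.02589 — 2 statements merged into one kernel-verified Lean document; each statement's English description precedes it below -/
import Mathlib

section
/- Let 𝒳, 𝒴 be finite sets, p a probability mass function on 𝒳×𝒴 with full support, and α∈(0,∞) with α≠1. Define p̄(x,y) = p(x|y)^α p(y) / ∑_{x',y'} p(x'|y')^α p(y'). Then the original distribution is recovered from p̄ by p(x,y) = p̄(x|y)^{1/α} p̄(y) · (∑_{x'} p̄(x'|y)^{1/α})^{α−1} / [∑_{y'} p̄(y') (∑_{x'} p̄(x'|y')^{1/α})^{α}]; in particular the tilting map p ↦ p̄ is a bijection on fully supported joint probability mass functions on 𝒳×𝒴. -/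
open Finset

variable {X Y : Type*} [Fintype X] [Fintype Y]

/-- `p` is a probability mass function on a finite type. -/
def IsPMF {Ω : Type*} [Fintype Ω] (p : Ω → ℝ) : Prop :=
  (∀ ω, 0 ≤ p ω) ∧ ∑ ω, p ω = 1

/-- Marginal distribution of the second component. -/
noncomputable def margY (p : X × Y → ℝ) (y : Y) : ℝ := ∑ x, p (x, y)

/-- Conditional distribution `p(x|y)`. -/
noncomputable def condXY (p : X × Y → ℝ) (x : X) (y : Y) : ℝ := p (x, y) / margY p y

/-- The tilted probability mass function `p̄`. -/
noncomputable def tilt (α : ℝ) (p : X × Y → ℝ) : X × Y → ℝ := fun (x, y) =>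
  condXY p x y ^ α * margY p y / ∑ xy : X × Y, condXY p xy.1 xy.2 ^ α * margY p xy.2

section Auxiliary

omit [Fintype Y] in
theorem margY_pos [Nonempty X] {p : X × Y → ℝ} (hp : ∀ xy, 0 < p xy) (y : Y) :
    0 < margY p y :=
  sum_pos (fun x _ => hp (x, y)) univ_nonempty

omit [Fintype Y] in
theorem condXY_pos {p : X × Y → ℝ} (hp : ∀ xy, 0 < p xy) (x : X) (y : Y) :
    0 < condXY p x y :=
  have : Nonempty X := ⟨x⟩
  div_pos (hp _) (margY_pos hp y)

omit [Fintype Y] in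
theorem condXY_mul_margY {p : X × Y → ℝ} (hp : ∀ xy, 0 < p xy) (x : X) (y : Y) :
    condXY p x y * margY p y = p (x, y) :=
  have : Nonempty X := ⟨x⟩
  div_mul_cancel₀ _ (margY_pos hp y).ne'

omit [Fintype Y] in
theorem sum_condXY [Nonempty X] {p : X × Y → ℝ} (hp : ∀ xy, 0 < p xy) (y : Y) :
    ∑ x, condXY p x y = 1 := by
  simp only [condXY, ← sum_div]
  exact div_self (margY_pos hp y).ne'

theorem sum_margY (p : X × Y → ℝ) : ∑ y, margY p y = ∑ xy, p xy := by
  rw [Fintype.sum_prod_type_right]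
  rfl

/-- The power sum `∑ x, p(x|y) ^ s`. -/
noncomputable def condPowSum (s : ℝ) (p : X × Y → ℝ) (y : Y) : ℝ := ∑ x, condXY p x y ^ s

omit [Fintype Y] in
theorem condPowSum_pos [Nonempty X] (s : ℝ) {p : X × Y → ℝ} (hp : ∀ xy, 0 < p xy) (y : Y) :
    0 < condPowSum s p y :=
  sum_pos (fun x _ => Real.rpow_pos_of_pos (condXY_pos hp x y) s) univ_nonempty

/-- The normalizing constant of `tilt`. -/
noncomputable def tiltNorm (α : ℝ) (p : X × Y → ℝ) : ℝ := ∑ y, condPowSum α p y * margY p y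

theorem tiltNorm_pos [Nonempty X] [Nonempty Y] (α : ℝ) {p : X × Y → ℝ}
    (hp : ∀ xy, 0 < p xy) : 0 < tiltNorm α p :=
  sum_pos (fun y _ => mul_pos (condPowSum_pos α hp y) (margY_pos hp y)) univ_nonempty

theorem tilt_apply (α : ℝ) (p : X × Y → ℝ) (x : X) (y : Y) :
    tilt α p (x, y) = condXY p x y ^ α * margY p y / tiltNorm α p := by
  simp only [tilt, tiltNorm, condPowSum, Fintype.sum_prod_type_right, sum_mul]

theorem margY_tilt (α : ℝ) (p : X × Y → ℝ) (y : Y) :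
    margY (tilt α p) y = condPowSum α p y * margY p y / tiltNorm α p := by
  simp only [margY.eq_1 (tilt α p), tilt_apply, ← sum_div, ← sum_mul, condPowSum]

theorem condXY_tilt (α : ℝ) {p : X × Y → ℝ} (hp : ∀ xy, 0 < p xy) (x : X) (y : Y) :
    condXY (tilt α p) x y = condXY p x y ^ α / condPowSum α p y := by
  have : Nonempty X := ⟨x⟩
  have : Nonempty Y := ⟨y⟩
  have hm := (margY_pos hp y).ne'
  have hZ := (tiltNorm_pos α hp).ne'
  have hA := (condPowSum_pos α hp y).ne'
  rw [condXY.eq_1 (tilt α p), tilt_apply, margY_tilt]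
  field_simp

theorem condXY_tilt_rpow_inv {α : ℝ} (hα : α ≠ 0) {p : X × Y → ℝ} (hp : ∀ xy, 0 < p xy)
    (x : X) (y : Y) :
    condXY (tilt α p) x y ^ (1 / α) = condXY p x y / condPowSum α p y ^ (1 / α) := by
  have : Nonempty X := ⟨x⟩
  have hc := (condXY_pos hp x y).le
  rw [condXY_tilt α hp, Real.div_rpow (Real.rpow_nonneg hc α) (condPowSum_pos α hp y).le,
    ← Real.rpow_mul hc, mul_one_div_cancel hα, Real.rpow_one]

theorem condPowSum_tilt [Nonempty X] {α : ℝ} (hα : α ≠ 0) {p : X × Y → ℝ}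
    (hp : ∀ xy, 0 < p xy) (y : Y) :
    condPowSum (1 / α) (tilt α p) y = (condPowSum α p y ^ (1 / α))⁻¹ := by
  rw [condPowSum.eq_1 (1 / α)]
  simp only [condXY_tilt_rpow_inv hα hp, ← sum_div, sum_condXY hp]
  exact one_div _

/-- The normalizing constant of `untilt`. -/
noncomputable def untiltNorm (α : ℝ) (r : X × Y → ℝ) : ℝ :=
  ∑ y, margY r y * condPowSum (1 / α) r y ^ α

/-- The explicit inverse of the tilting map. -/
noncomputable def untilt (α : ℝ) (r : X × Y → ℝ) : X × Y → ℝ := fun (x, y) =>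
  condXY r x y ^ (1 / α) * margY r y * condPowSum (1 / α) r y ^ (α - 1) / untiltNorm α r

theorem untiltNorm_pos [Nonempty X] [Nonempty Y] (α : ℝ) {r : X × Y → ℝ}
    (hr : ∀ xy, 0 < r xy) : 0 < untiltNorm α r :=
  sum_pos (fun y _ => mul_pos (margY_pos hr y)
    (Real.rpow_pos_of_pos (condPowSum_pos _ hr y) α)) univ_nonempty

theorem untilt_pos (α : ℝ) {r : X × Y → ℝ} (hr : ∀ xy, 0 < r xy) (xy : X × Y) :
    0 < untilt α r xy := by
  have : Nonempty X := ⟨xy.1⟩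
  have : Nonempty Y := ⟨xy.2⟩
  exact div_pos (mul_pos (mul_pos (Real.rpow_pos_of_pos (condXY_pos hr _ _) _)
    (margY_pos hr _)) (Real.rpow_pos_of_pos (condPowSum_pos _ hr _) _)) (untiltNorm_pos α hr)

theorem margY_untilt [Nonempty X] (α : ℝ) {r : X × Y → ℝ} (hr : ∀ xy, 0 < r xy) (y : Y) :
    margY (untilt α r) y = margY r y * condPowSum (1 / α) r y ^ α / untiltNorm α r := by
  have hB := condPowSum_pos (1 / α) hr y
  have hsum : margY (untilt α r) y = condPowSum (1 / α) r y * margY r y *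
      condPowSum (1 / α) r y ^ (α - 1) / untiltNorm α r := by
    rw [margY.eq_1 (untilt α r), condPowSum.eq_1 (1 / α) r y]
    simp only [untilt, ← sum_div, ← sum_mul, condPowSum]
  rw [hsum, Real.rpow_sub_one hB.ne']
  field_simp

theorem isPMF_untilt [Nonempty X] [Nonempty Y] (α : ℝ) {r : X × Y → ℝ}
    (hr : ∀ xy, 0 < r xy) : IsPMF (untilt α r) := by
  refine ⟨fun xy => (untilt_pos α hr xy).le, ?_⟩
  rw [← sum_margY]
  simp only [margY_untilt α hr, ← sum_div]
  exact div_self (untiltNorm_pos α hr).ne'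

theorem condXY_untilt (α : ℝ) {r : X × Y → ℝ} (hr : ∀ xy, 0 < r xy) (x : X) (y : Y) :
    condXY (untilt α r) x y = condXY r x y ^ (1 / α) / condPowSum (1 / α) r y := by
  have : Nonempty X := ⟨x⟩
  have : Nonempty Y := ⟨y⟩
  have hB := condPowSum_pos (1 / α) hr y
  have hBα := (Real.rpow_pos_of_pos hB α).ne'
  have hm := (margY_pos hr y).ne'
  have hN := (untiltNorm_pos α hr).ne'
  rw [condXY.eq_1 (untilt α r), margY_untilt α hr, untilt, Real.rpow_sub_one hB.ne']
  field_simp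

theorem condXY_untilt_rpow_mul_margY {α : ℝ} (hα : α ≠ 0) {r : X × Y → ℝ}
    (hr : ∀ xy, 0 < r xy) (x : X) (y : Y) :
    condXY (untilt α r) x y ^ α * margY (untilt α r) y = r (x, y) / untiltNorm α r := by
  have : Nonempty X := ⟨x⟩
  have hc := (condXY_pos hr x y).le
  have hB := condPowSum_pos (1 / α) hr y
  have hBα := (Real.rpow_pos_of_pos hB α).ne'
  rw [condXY_untilt α hr, margY_untilt α hr, Real.div_rpow (Real.rpow_nonneg hc _) hB.le,
    ← Real.rpow_mul hc, one_div_mul_cancel hα, Real.rpow_one, ← condXY_mul_margY hr x y]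
  field_simp

theorem tilt_untilt [Nonempty X] [Nonempty Y] {α : ℝ} (hα : α ≠ 0) {r : X × Y → ℝ}
    (hr : IsPMF r) (hpos : ∀ xy, 0 < r xy) : tilt α (untilt α r) = r := by
  have hN := (untiltNorm_pos α hpos).ne'
  ext ⟨x, y⟩
  simp only [tilt, condXY_untilt_rpow_mul_margY hα hpos, ← sum_div, hr.2]
  field_simp

theorem untiltNorm_tilt [Nonempty X] {α : ℝ} (hα : α ≠ 0) {p : X × Y → ℝ}
    (hp : IsPMF p) (hpos : ∀ xy, 0 < p xy) :
    untiltNorm α (tilt α p) = (tiltNorm α p)⁻¹ := by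
  have h (y : Y) : margY (tilt α p) y * condPowSum (1 / α) (tilt α p) y ^ α =
      margY p y / tiltNorm α p := by
    have hA := condPowSum_pos α hpos y
    rw [margY_tilt, condPowSum_tilt hα hpos, Real.inv_rpow (Real.rpow_nonneg hA.le _),
      ← Real.rpow_mul hA.le, one_div_mul_cancel hα, Real.rpow_one]
    field_simp
  simp only [untiltNorm, h, ← sum_div, sum_margY, hp.2]
  exact one_div _

theorem untilt_tilt {α : ℝ} (hα : α ≠ 0) {p : X × Y → ℝ}
    (hp : IsPMF p) (hpos : ∀ xy, 0 < p xy) : untilt α (tilt α p) = p := by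
  ext ⟨x, y⟩
  have : Nonempty X := ⟨x⟩
  have : Nonempty Y := ⟨y⟩
  have hA := condPowSum_pos α hpos y
  have hR := (Real.rpow_pos_of_pos hA (1 / α)).ne'
  have hZ := (tiltNorm_pos α hpos).ne'
  have hpow : (condPowSum α p y ^ (1 / α)) ^ α = condPowSum α p y := by
    rw [← Real.rpow_mul hA.le, one_div_mul_cancel hα, Real.rpow_one]
  rw [untilt, untiltNorm_tilt hα hp hpos, condXY_tilt_rpow_inv hα hpos, margY_tilt,
    condPowSum_tilt hα hpos, Real.rpow_sub_one (inv_ne_zero hR),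
    Real.inv_rpow (Real.rpow_nonneg hA.le _), hpow, ← condXY_mul_margY hpos x y]
  field_simp

end Auxiliary

/-- **Inversion of the tilting map**: for a fully supported pmf `p`, the original
distribution is recovered from `p̄ = tilt α p` by the explicit formula, and the
tilting map is a bijection on fully supported joint pmfs. -/
theorem tilt_inversion_and_bijective (α : ℝ) (hα0 : 0 < α) (hα1 : α ≠ 1)
    (p : X × Y → ℝ) (hp : IsPMF p) (hpos : ∀ xy, 0 < p xy) :
    (∀ x y, p (x, y) =
      condXY (tilt α p) x y ^ (1 / α) * margY (tilt α p) y *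
        (∑ x', condXY (tilt α p) x' y ^ (1 / α)) ^ (α - 1) /
        ∑ y', margY (tilt α p) y' * (∑ x', condXY (tilt α p) x' y' ^ (1 / α)) ^ α) ∧
    (∀ q q' : X × Y → ℝ, IsPMF q → (∀ xy, 0 < q xy) → IsPMF q' → (∀ xy, 0 < q' xy) →
      tilt α q = tilt α q' → q = q') ∧
    (∀ r : X × Y → ℝ, IsPMF r → (∀ xy, 0 < r xy) →
      ∃ q : X × Y → ℝ, IsPMF q ∧ (∀ xy, 0 < q xy) ∧ tilt α q = r) := by
  refine ⟨fun x y => (congrFun (untilt_tilt hα0.ne' hp hpos) (x, y)).symm, ?_, ?_⟩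
  · intro q q' hq hqpos hq' hqpos' h
    rw [← untilt_tilt hα0.ne' hq hqpos, h, untilt_tilt hα0.ne' hq' hqpos']
  · intro r hr hrpos
    have hne : Nonempty (X × Y) := by
      by_contra hempty
      rw [not_nonempty_iff] at hempty
      simpa using hr.2
    have := hne.map Prod.fst
    have := hne.map Prod.snd
    exact ⟨untilt α r, isPMF_untilt α hrpos, untilt_pos α hrpos, tilt_untilt hα0.ne' hr hrpos⟩
end

section
/- Let ρ_{ABC} be a density matrix on ℂ^{d_A}⊗ℂ^{d_B}⊗ℂ^{d_C} and α∈(0,∞) with α≠1. Define ρ̃_{ABC} = (ρ_C^{(1−α)/(2α)} ρ_{ABC} ρ_C^{(1−α)/(2α)})^α / Tr[(ρ_C^{(1−α)/(2α)} ρ_{ABC} ρ_C^{(1−α)/(2α)})^α]. Then H̃↓_α(AB|C)_ρ = H̄↑_{1/α}(A|BC)_{ρ̃} + H̃↓_α(B|C)_ρ, and moreover H̃↓_α(AB|C)_ρ = H̄↑_{1/α}(AB|C)_{ρ̃}. -/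
open Matrix Kronecker
open scoped ComplexOrder

/-- Real power of a matrix, defined spectrally for Hermitian matrices
(eigenvalue `0` is sent to `0` via `Real.rpow`); junk value `0` otherwise. -/
noncomputable def mpow {n : Type*} [Fintype n] [DecidableEq n]
    (M : Matrix n n ℂ) (r : ℝ) : Matrix n n ℂ :=
  if hM : M.IsHermitian then
    (hM.eigenvectorUnitary : Matrix n n ℂ) *
      Matrix.diagonal (fun i => ((hM.eigenvalues i ^ r : ℝ) : ℂ)) *
        (star (hM.eigenvectorUnitary : Matrix n n ℂ))
  else 0

/-- Partial trace over the first tensor factor. -/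
noncomputable def ptrA {dA dB : Type*} [Fintype dA]
    (M : Matrix (dA × dB) (dA × dB) ℂ) : Matrix dB dB ℂ :=
  Matrix.of fun b b' => ∑ a, M (a, b) (a, b')

variable {dA dB : Type*} [Fintype dA] [Fintype dB] [DecidableEq dA] [DecidableEq dB]

/-- The sandwiched state `ρ_B^{(1−α)/(2α)} ρ_{AB} ρ_B^{(1−α)/(2α)}`. -/
noncomputable def sandwich (α : ℝ) (ρ : Matrix (dA × dB) (dA × dB) ℂ) :
    Matrix (dA × dB) (dA × dB) ℂ :=
  ((1 : Matrix dA dA ℂ) ⊗ₖ mpow (ptrA ρ) ((1 - α) / (2 * α))) * ρ *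
    ((1 : Matrix dA dA ℂ) ⊗ₖ mpow (ptrA ρ) ((1 - α) / (2 * α)))

/-- The conditional Rényi entropy `H̃↓_α(A|B)_ρ`. -/
noncomputable def Hdown (α : ℝ) (ρ : Matrix (dA × dB) (dA × dB) ℂ) : ℝ :=
  (1 / (1 - α)) * Real.log (mpow (sandwich α ρ) α).trace.re

/-- The conditional Rényi entropy `H̄↑_α(A|B)_ρ`. -/
noncomputable def Hup (α : ℝ) (ρ : Matrix (dA × dB) (dA × dB) ℂ) : ℝ :=
  (α / (1 - α)) * Real.log (mpow (ptrA (mpow ρ α)) (1 / α)).trace.re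

/-- The tilted state `ρ̄_{AB}`. -/
noncomputable def qtilt (α : ℝ) (ρ : Matrix (dA × dB) (dA × dB) ℂ) :
    Matrix (dA × dB) (dA × dB) ℂ :=
  ((mpow (sandwich α ρ) α).trace)⁻¹ • mpow (sandwich α ρ) α

variable {dC : Type*} [Fintype dC] [DecidableEq dC]

/-- Reindex a tripartite matrix on `A × (B × C)` as a bipartite matrix on `(A × B) × C`. -/
noncomputable def asABC (ρ : Matrix (dA × dB × dC) (dA × dB × dC) ℂ) :
    Matrix ((dA × dB) × dC) ((dA × dB) × dC) ℂ :=
  Matrix.reindex (Equiv.prodAssoc dA dB dC).symm (Equiv.prodAssoc dA dB dC).symm ρ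

/-- Reindex a bipartite matrix on `(A × B) × C` back to `A × (B × C)`. -/
noncomputable def asA_BC (ρ : Matrix ((dA × dB) × dC) ((dA × dB) × dC) ℂ) :
    Matrix (dA × dB × dC) (dA × dB × dC) ℂ :=
  Matrix.reindex (Equiv.prodAssoc dA dB dC) (Equiv.prodAssoc dA dB dC) ρ

section MatrixPower

variable {n : Type*} [Fintype n] [DecidableEq n] {M : Matrix n n ℂ}

lemma mpow_eq_cfc (hM : M.IsHermitian) (r : ℝ) : mpow M r = cfc (fun x : ℝ => x ^ r) M := by
  rw [hM.cfc_eq, mpow, dif_pos hM, Matrix.IsHermitian.cfc, Unitary.conjStarAlgAut_apply]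
  rfl

lemma continuousOn_spectrum (M : Matrix n n ℂ) (f : ℝ → ℝ) : ContinuousOn f (spectrum ℝ M) :=
  M.finite_real_spectrum.continuousOn f

lemma Matrix.PosSemidef.nonneg_of_mem_spectrum (hM : M.PosSemidef) {x : ℝ}
    (hx : x ∈ spectrum ℝ M) : 0 ≤ x := by
  rw [hM.1.spectrum_real_eq_range_eigenvalues] at hx
  obtain ⟨i, rfl⟩ := hx
  exact hM.eigenvalues_nonneg i

lemma Matrix.PosSemidef.mpow (hM : M.PosSemidef) (r : ℝ) : (mpow M r).PosSemidef := by
  rw [_root_.mpow, dif_pos hM.1]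
  refine PosSemidef.mul_mul_conjTranspose_same (PosSemidef.diagonal fun i => ?_) _
  exact Complex.zero_le_real.2 (Real.rpow_nonneg (hM.eigenvalues_nonneg i) r)

lemma mpow_one (hM : M.PosSemidef) : mpow M 1 = M := by
  simp only [mpow_eq_cfc hM.1, Real.rpow_one]
  exact cfc_id' ℝ M hM.1.isSelfAdjoint

lemma mpow_mpow (hM : M.PosSemidef) (r s : ℝ) : mpow (mpow M r) s = mpow M (r * s) := by
  rw [mpow_eq_cfc (hM.mpow r).1, mpow_eq_cfc hM.1, mpow_eq_cfc hM.1,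
    ← cfc_comp' _ _ M ((M.finite_real_spectrum.image _).continuousOn _)
      (continuousOn_spectrum M _) hM.1.isSelfAdjoint]
  exact cfc_congr fun x hx => (Real.rpow_mul (hM.nonneg_of_mem_spectrum hx) r s).symm

lemma mpow_zero_matrix {r : ℝ} (hr : r ≠ 0) : mpow (0 : Matrix n n ℂ) r = 0 := by
  simp [mpow_eq_cfc isHermitian_zero, cfc_apply_zero, Real.zero_rpow hr]

lemma mpow_smul (hM : M.PosSemidef) {c : ℝ} (hc : 0 ≤ c) (r : ℝ) :
    mpow ((c : ℂ) • M) r = ((c ^ r : ℝ) : ℂ) • mpow M r := by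
  have hcM : ((c : ℂ) • M).PosSemidef := hM.smul (by exact_mod_cast hc)
  have hsmul (a : ℝ) (N : Matrix n n ℂ) : (a : ℂ) • N = a • N := by ext; simp
  rw [mpow_eq_cfc hcM.1, mpow_eq_cfc hM.1, hsmul, hsmul, ← cfc_const_mul_id c M hM.1.isSelfAdjoint,
    ← cfc_comp' _ _ M ((M.finite_real_spectrum.image _).continuousOn _)
      (continuousOn_spectrum M _) hM.1.isSelfAdjoint, ← cfc_const_mul _ _ M (continuousOn_spectrum M _)]
  exact cfc_congr fun x hx => Real.mul_rpow hc (hM.nonneg_of_mem_spectrum hx)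

lemma mpow_mul_self_mul_mpow (hM : M.PosSemidef) {r : ℝ} (hr : r + 1 + r ≠ 0) :
    mpow M r * M * mpow M r = mpow M (r + 1 + r) := by
  have hc := continuousOn_spectrum M
  nth_rw 2 [← mpow_one hM]
  simp only [mpow_eq_cfc hM.1]
  rw [← cfc_mul _ _ M (hc _) (hc _), ← cfc_mul _ _ M (hc _) (hc _)]
  refine cfc_congr fun x hx => ?_
  rcases (hM.nonneg_of_mem_spectrum hx).eq_or_lt with rfl | h
  · simp [Real.zero_rpow hr]
  · simp only [Real.rpow_add h]

lemma mpow_reindex {m : Type*} [Fintype m] [DecidableEq m] (e : n ≃ m) (hM : M.PosSemidef)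
    (r : ℝ) : mpow (reindex e e M) r = reindex e e (mpow M r) := by
  let φ : Matrix n n ℂ →⋆ₐ[ℂ] Matrix m m ℂ :=
    { (reindexAlgEquiv ℂ ℂ e : Matrix n n ℂ →ₐ[ℂ] Matrix m m ℂ) with
      map_star' := fun _ => rfl }
  have hφ : Continuous φ := continuous_id.matrix_submatrix _ _
  have hM' : (reindex e e M).PosSemidef := hM.submatrix _
  rw [mpow_eq_cfc hM'.1, mpow_eq_cfc hM.1]
  exact (φ.map_cfc _ M (continuousOn_spectrum M _) hφ hM.1.isSelfAdjoint hM'.1.isSelfAdjoint).symm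

end MatrixPower

section PartialTrace

variable {m n : Type*} [Fintype m]

lemma trace_ptrA [Fintype n] (M : Matrix (m × n) (m × n) ℂ) : (ptrA M).trace = M.trace := by
  simp only [Matrix.trace, ptrA, diag_apply, of_apply, Fintype.sum_prod_type]
  exact Finset.sum_comm

lemma ptrA_smul (c : ℂ) (M : Matrix (m × n) (m × n) ℂ) : ptrA (c • M) = c • ptrA M := by
  ext
  simp [ptrA, Finset.mul_sum]

lemma ptrA_eq_sum (M : Matrix (m × n) (m × n) ℂ) :
    ptrA M = ∑ a, M.submatrix (Prod.mk a) (Prod.mk a) := by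
  ext
  simp [ptrA, Matrix.sum_apply]

lemma Matrix.PosSemidef.ptrA {M : Matrix (m × n) (m × n) ℂ} (hM : M.PosSemidef) :
    (ptrA M).PosSemidef := by
  rw [ptrA_eq_sum]
  exact posSemidef_sum _ fun a _ => hM.submatrix _

lemma ptrA_one_kronecker_mul_mul [Fintype n] [DecidableEq m] (K L : Matrix n n ℂ)
    (M : Matrix (m × n) (m × n) ℂ) :
    ptrA (((1 : Matrix m m ℂ) ⊗ₖ K) * M * ((1 : Matrix m m ℂ) ⊗ₖ L)) = K * ptrA M * L := by
  ext i j
  simp only [ptrA, mul_apply, of_apply, kroneckerMap_apply, Fintype.sum_prod_type, one_apply,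
    ite_mul, mul_ite, one_mul, zero_mul, mul_zero, Finset.sum_ite_irrel,
    Finset.sum_const_zero, Finset.sum_ite_eq, Finset.sum_ite_eq', Finset.mem_univ, if_true,
    Finset.mul_sum, Finset.sum_mul]
  rw [Finset.sum_comm]
  refine Finset.sum_congr rfl fun x _ => ?_
  rw [Finset.sum_comm]

lemma ptrA_ptrA {k : Type*} [Fintype k] (M : Matrix (k × m × n) (k × m × n) ℂ) :
    ptrA (ptrA M) = ptrA (asABC M) := by
  ext i j
  simp only [ptrA, asABC, of_apply, reindex_apply, submatrix_apply, Fintype.sum_prod_type]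
  exact Finset.sum_comm

end PartialTrace

section Sandwich

variable {α : ℝ} {ρ : Matrix (dA × dB) (dA × dB) ℂ}

lemma Matrix.PosSemidef.sandwich (hρ : ρ.PosSemidef) (α : ℝ) : (sandwich α ρ).PosSemidef := by
  have h : ((1 : Matrix dA dA ℂ) ⊗ₖ
      _root_.mpow (_root_.ptrA ρ) ((1 - α) / (2 * α))).IsHermitian := by
    rw [IsHermitian, conjTranspose_kronecker, (hρ.ptrA.mpow _).1.eq, conjTranspose_one]
  have := hρ.mul_mul_conjTranspose_same
    ((1 : Matrix dA dA ℂ) ⊗ₖ _root_.mpow (_root_.ptrA ρ) ((1 - α) / (2 * α)))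
  rwa [h.eq] at this

lemma ptrA_sandwich (hρ : ρ.PosSemidef) (hα : 0 < α) :
    ptrA (sandwich α ρ) = mpow (ptrA ρ) (1 / α) := by
  have hexp : (1 - α) / (2 * α) + 1 + (1 - α) / (2 * α) = 1 / α := by
    field_simp
    ring
  rw [sandwich, ptrA_one_kronecker_mul_mul,
    mpow_mul_self_mul_mpow hρ.ptrA (by rw [hexp]; positivity), hexp]

lemma mpow_ptrA_sandwich (hρ : ρ.PosSemidef) (hα : 0 < α) :
    mpow (ptrA (sandwich α ρ)) α = ptrA ρ := by
  rw [ptrA_sandwich hρ hα, mpow_mpow hρ.ptrA, one_div_mul_cancel hα.ne', mpow_one hρ.ptrA]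

lemma trace_mpow_sandwich_ne_zero (hρ : ρ.PosSemidef) (htr : ρ.trace = 1) (hα : 0 < α) :
    (mpow (sandwich α ρ) α).trace ≠ 0 := by
  have hX := hρ.sandwich α
  intro h
  rw [(hX.mpow α).trace_eq_zero_iff] at h
  have hX0 : sandwich α ρ = 0 := by
    rw [← mpow_one hX, ← mul_one_div_cancel hα.ne', ← mpow_mpow hX, h,
      mpow_zero_matrix (by positivity)]
  have hptr : ptrA ρ = 0 := by
    rw [← mpow_ptrA_sandwich hρ hα, hX0, ← zero_smul ℂ (0 : Matrix (dA × dB) (dA × dB) ℂ),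
      ptrA_smul, zero_smul, mpow_zero_matrix hα.ne']
  rw [← trace_ptrA, hptr, trace_zero] at htr
  exact zero_ne_one htr

lemma Matrix.PosSemidef.trace_eq_ofReal {n : Type*} [Fintype n] {M : Matrix n n ℂ}
    (hM : M.PosSemidef) : M.trace = (M.trace.re : ℂ) :=
  Complex.ext rfl (Complex.nonneg_iff.mp hM.trace_nonneg).2.symm

lemma trace_mpow_sandwich_re_pos (hρ : ρ.PosSemidef) (htr : ρ.trace = 1) (hα : 0 < α) :
    0 < (mpow (sandwich α ρ) α).trace.re := by
  have hY := (hρ.sandwich α).mpow α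
  refine (Complex.nonneg_iff.mp hY.trace_nonneg).1.lt_of_ne fun h => ?_
  refine trace_mpow_sandwich_ne_zero hρ htr hα ?_
  rw [hY.trace_eq_ofReal, ← h, Complex.ofReal_zero]

lemma Hup_one_div_smul_mpow {X : Matrix (dA × dB) (dA × dB) ℂ} (hX : X.PosSemidef) (hα : 0 < α)
    {t : ℝ} (ht : 0 < t) :
    Hup (1 / α) ((t : ℂ)⁻¹ • mpow X α) =
      1 / (α - 1) * Real.log ((mpow (ptrA X) α).trace.re / t) := by
  have hcoef : 1 / α / (1 - 1 / α) = 1 / (α - 1) := by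
    rw [div_div, mul_sub, mul_one, mul_one_div_cancel hα.ne']
  have hpow : (t⁻¹ ^ (1 / α)) ^ α = t⁻¹ := by
    rw [← Real.rpow_mul (inv_nonneg.2 ht.le), one_div_mul_cancel hα.ne', Real.rpow_one]
  rw [Hup, hcoef, ← Complex.ofReal_inv, mpow_smul (hX.mpow α) (inv_nonneg.2 ht.le),
    mpow_mpow hX, mul_one_div_cancel hα.ne', mpow_one hX, ptrA_smul, one_div_one_div,
    mpow_smul hX.ptrA (by positivity), hpow, trace_smul, smul_eq_mul, Complex.re_ofReal_mul,
    inv_mul_eq_div]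

end Sandwich

section Tripartite

lemma asA_BC_one_kronecker {k m n : Type*} [DecidableEq k] [DecidableEq m] (K : Matrix n n ℂ) :
    asA_BC ((1 : Matrix (k × m) (k × m) ℂ) ⊗ₖ K) =
      (1 : Matrix k k ℂ) ⊗ₖ ((1 : Matrix m m ℂ) ⊗ₖ K) := by
  rw [← one_kronecker_one, asA_BC, kronecker_assoc]

lemma asA_BC_mul (M N : Matrix ((dA × dB) × dC) ((dA × dB) × dC) ℂ) :
    asA_BC (M * N) = asA_BC M * asA_BC N :=
  map_mul (reindexAlgEquiv ℂ ℂ (Equiv.prodAssoc dA dB dC)) M N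

lemma ptrA_asA_BC_sandwich (α : ℝ) (ρ : Matrix (dA × dB × dC) (dA × dB × dC) ℂ) :
    ptrA (asA_BC (sandwich α (asABC ρ))) = sandwich α (ptrA ρ) := by
  rw [sandwich, asA_BC_mul, asA_BC_mul, asA_BC_one_kronecker, sandwich, ptrA_ptrA]
  exact ptrA_one_kronecker_mul_mul _ _ ρ

end Tripartite

/-- **Quantum Rényi chain rule**: with `ρ̃_{ABC}` the `C`-tilted state,
`H̃↓_α(AB|C)_ρ = H̄↑_{1/α}(A|BC)_{ρ̃} + H̃↓_α(B|C)_ρ` and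
`H̃↓_α(AB|C)_ρ = H̄↑_{1/α}(AB|C)_{ρ̃}`. -/
theorem quantum_renyi_chain_rule
    (ρ : Matrix (dA × dB × dC) (dA × dB × dC) ℂ) (hρ : ρ.PosSemidef) (htr : ρ.trace = 1)
    (α : ℝ) (hα0 : 0 < α) (hα1 : α ≠ 1) :
    Hdown α (asABC ρ) =
        Hup (1 / α) (asA_BC (qtilt α (asABC ρ))) + Hdown α (ptrA ρ) ∧
    Hdown α (asABC ρ) = Hup (1 / α) (qtilt α (asABC ρ)) := by
  have hρ' : (asABC ρ).PosSemidef := hρ.submatrix _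
  have htr' : (asABC ρ).trace = 1 := by
    rw [← trace_ptrA, ← ptrA_ptrA, trace_ptrA, trace_ptrA, htr]
  have hX := hρ'.sandwich α
  have ht := trace_mpow_sandwich_re_pos hρ' htr' hα0
  have ht' := trace_mpow_sandwich_re_pos hρ.ptrA ((trace_ptrA ρ).trans htr) hα0
  have hα : 1 - α ≠ 0 := sub_ne_zero.2 hα1.symm
  have hα' : α - 1 ≠ 0 := sub_ne_zero.2 hα1
  rw [qtilt, (hX.mpow α).trace_eq_ofReal]
  constructor
  · have hY : asA_BC ((((mpow (sandwich α (asABC ρ)) α).trace.re : ℝ) : ℂ)⁻¹ •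
        mpow (sandwich α (asABC ρ)) α) =
        (((mpow (sandwich α (asABC ρ)) α).trace.re : ℝ) : ℂ)⁻¹ •
          mpow (asA_BC (sandwich α (asABC ρ))) α := by
      rw [asA_BC, asA_BC, mpow_reindex _ hX]
      rfl
    have hX' : (asA_BC (sandwich α (asABC ρ))).PosSemidef := hX.submatrix _
    rw [hY, Hup_one_div_smul_mpow hX' hα0 ht, ptrA_asA_BC_sandwich,
      Real.log_div ht'.ne' ht.ne', Hdown, Hdown]
    field_simp
    ring
  · rw [Hup_one_div_smul_mpow hX hα0 ht, mpow_ptrA_sandwich hρ' hα0, trace_ptrA, htr', Hdown,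
      Complex.one_re, one_div ((mpow _ _).trace.re), Real.log_inv]
    field_simp
    ring
end
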